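/- Let (Δ,Θ) be a directive bi-sequence with associated prefixes (w_n) and let n ≥ 1. Suppose the prefix of length n of (Δ,Θ) is normalized, Assumption A holds for (w_n, w_{n+1}), and exactly one pseudopalindromic prefix is missed between w_n and w_{n+1}. If w_n = w_{n−1}·c·ϑ(w_{n−1}) for some letter c ∈ {0,1,2} and some ϑ ∈ {R,E_0,E_1,E_2} (equivalently, |w_n| = 2|w_{n−1}| + 1), then there exist a letter d ∈ {0,1,2} and ϑ' ∈ {R,E_0,E_1,E_2} such that w_{n+1} = w_n·d·ϑ'(w_n) (equivalently, |w_{n+1}| = 2|w_n| + 1). -/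

import Mathlib

/-- The ternary alphabet. -/
abbrev Letter := Fin 3

/-- Finite words over the ternary alphabet. -/
abbrev Word := List Letter

/-- The four involutory antimorphisms of ternary words: the reversal `R`
and, for each letter `i`, the antimorphism `E i`. -/
inductive AM where
  | R : AM
  | E : Letter → AM
deriving DecidableEq

/-- The action of an antimorphism on a single letter: `R` fixes every letter,
and `E i` fixes `i` and exchanges the other two letters (in `Fin 3`,
this involution is `a ↦ -(i + a)`). -/
def AM.letter : AM → Letter → Letter
  | .R, _a => _a
  | .E i, a => -(i + a)

/-- The action of an antimorphism on a word: letterwise image followed by reversal. -/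
def AM.apply (t : AM) (w : Word) : Word := (w.map t.letter).reverse

/-- A word is a pseudopalindrome if it is a `ϑ`-palindrome for some
`ϑ ∈ {R, E_0, E_1, E_2}`. -/
def IsPseudopal (w : Word) : Prop := ∃ t : AM, t.apply w = w

/-- `v` is an image of `w` if `v = ϑ(w)` for some `ϑ ∈ {R, E_0, E_1, E_2}`. -/
def IsImage (w v : Word) : Prop := ∃ t : AM, v = t.apply w

/-- `v` is the `ϑ`-palindromic closure of `u`: the shortest `ϑ`-palindrome
having `u` as a prefix. -/
def IsPalClosure (t : AM) (u v : Word) : Prop :=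
  u <+: v ∧ t.apply v = v ∧
    ∀ v' : Word, u <+: v' → t.apply v' = v' → v.length ≤ v'.length

/-- `w` is the sequence of prefixes associated with the directive bi-sequence
`(Δ, Θ)`: `w 0 = ε` and `w (n+1) = (w n · δ_{n+1})^{ϑ_{n+1}}`. -/
def DirectivePrefixes (Δ : ℕ → Letter) (Θ : ℕ → AM) (w : ℕ → Word) : Prop :=
  w 0 = [] ∧ ∀ n : ℕ, IsPalClosure (Θ (n + 1)) (w n ++ [Δ (n + 1)]) (w (n + 1))

/-- A pseudopalindromic prefix `v` of `w_{n+1}` is missed between `w_n` and `w_{n+1}`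
if `|w_n| < |v| < |w_{n+1}|`. -/
def MissedBetween (wn wn1 v : Word) : Prop :=
  v <+: wn1 ∧ IsPseudopal v ∧ wn.length < v.length ∧ v.length < wn1.length

/-- An image of `u` occurs in `v` at (0-indexed) position `p`. -/
def OccursImageAt (u v : Word) (p : ℕ) : Prop :=
  p + u.length ≤ v.length ∧ IsImage u ((v.drop p).take u.length)

/-- Assumption A for the pair `(wn, wn1)`: some image of `wn` occurs in `wn1`
at a position `p` with `0 < p < |wn1| - |wn|`, overlapping both the prefix
occurrence of `wn` and the suffix occurrence of an image of `wn`. -/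
def AssumptionA (wn wn1 : Word) : Prop :=
  ∃ p : ℕ, 0 < p ∧ p < wn1.length - wn.length ∧ p < wn.length ∧
    wn1.length - wn.length < p + wn.length ∧ OccursImageAt wn wn1 p

/-- The prefix of length `n` of the directive bi-sequence is normalized:
every pseudopalindromic prefix of `w n` equals `w k` for some `k ≤ n`. -/
def NormalizedUpTo (w : ℕ → Word) (n : ℕ) : Prop :=
  ∀ v : Word, v <+: w n → IsPseudopal v → ∃ k : ℕ, k ≤ n ∧ v = w k

/-- `rep u l` is the `l`-fold concatenation `u^l`. -/
def rep (u : Word) (l : ℕ) : Word := (List.replicate l u).flatten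

/-- `rmSuf x y` is `x · y⁻¹`: the word `x` with its suffix of length `|y|` removed. -/
def rmSuf (x y : Word) : Word := x.take (x.length - y.length)

/-- `v` is a prefix of the infinite periodic word `pat^ω`. -/
def IsPrefixOfPow (pat v : Word) : Prop :=
  ∀ q : ℕ, ∀ hq : q < v.length, ∃ hp : q % pat.length < pat.length,
    v.get ⟨q, hq⟩ = pat.get ⟨q % pat.length, hp⟩
instance AM.instFintype : Fintype AM :=
  Fintype.ofEquiv (Option Letter)
    { toFun := fun o => o.elim .R .E
      invFun := fun t => match t with
        | .R => none
        | .E i => some i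
      left_inv := by rintro (_ | _) <;> rfl
      right_inv := by rintro (_ | _) <;> rfl }

theorem AM.letter_letter (t : AM) (a : Letter) : t.letter (t.letter a) = a := by
  revert t a; decide

theorem AM.exists_letter_conj (s r : AM) :
    ∃ t : AM, ∀ a, t.letter a = s.letter (r.letter (s.letter a)) := by
  revert s r; decide

/-- A composition of three letter maps is either again a letter map (as is the one with the first
two factors exchanged), or a `3`-cycle, whose square has no fixed point. -/
theorem AM.exists_letter_comp_or (r t s : AM) :
    (∃ k : AM, ∀ a, k.letter a = t.letter (r.letter (s.letter a))) ∨
      ∀ a, r.letter (t.letter (s.letter (r.letter (t.letter (s.letter a))))) ≠ a := by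
  revert r t s; decide

theorem AM.length_apply (t : AM) (u : Word) : (t.apply u).length = u.length := by
  simp [AM.apply]

theorem AM.getD_apply (t : AM) (u : Word) {i j : ℕ} (h : i + j + 1 = u.length) :
    (t.apply u).getD j 0 = t.letter (u.getD i 0) := by
  have hj : j < (t.apply u).length := by rw [t.length_apply]; omega
  have hi : i < u.length := by omega
  rw [List.getD_eq_getElem _ _ hj, List.getD_eq_getElem _ _ hi]
  simp only [AM.apply, List.getElem_reverse, List.getElem_map, List.length_map]
  congr 2
  omega

theorem List.eq_of_getD {u v : Word} (hl : u.length = v.length)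
    (h : ∀ i < u.length, u.getD i 0 = v.getD i 0) : u = v := by
  refine List.ext_getElem hl fun i h₁ h₂ => ?_
  simpa [List.getD_eq_getElem, h₁, h₂] using h i h₁

theorem List.getD_take_drop (x : Word) {p m i : ℕ} (hi : i < m) :
    ((x.drop p).take m).getD i 0 = x.getD (p + i) 0 := by
  simp [List.getD_eq_getElem?_getD, hi]

/-- A prefix is a pseudopalindrome as soon as its letters at mirrored positions correspond. -/
theorem AM.apply_take_eq (t : AM) (x : Word) {m : ℕ} (hm : m ≤ x.length)
    (h : ∀ i j, i + j + 1 = m → x.getD j 0 = t.letter (x.getD i 0)) :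
    t.apply (x.take m) = x.take m := by
  have hl : (x.take m).length = m := by simp [hm]
  have htake : ∀ i < m, (x.take m).getD i 0 = x.getD i 0 := fun i hi => by
    simpa using List.getD_take_drop x (p := 0) hi
  refine List.eq_of_getD (t.length_apply _) fun j hj => ?_
  rw [t.length_apply, hl] at hj
  rw [t.getD_apply (i := m - 1 - j) _ (by omega), htake _ (by omega), htake _ hj]
  exact (h _ _ (by omega)).symm

theorem AM.apply_append (t : AM) (u v : Word) : t.apply (u ++ v) = t.apply v ++ t.apply u := by
  simp [AM.apply]

theorem AM.apply_apply (t : AM) (u : Word) : t.apply (t.apply u) = u := by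
  simp [AM.apply, Function.comp_def, AM.letter_letter]

theorem IsPalClosure.length_le {t : AM} {u v : Word} (h : IsPalClosure t u v) :
    v.length ≤ 2 * u.length := by
  have := h.2.2 (u ++ t.apply u) (List.prefix_append _ _)
    (by rw [AM.apply_append, AM.apply_apply])
  rw [List.length_append, AM.length_apply] at this
  omega

theorem DirectivePrefixes.isPrefix {Δ : ℕ → Letter} {Θ : ℕ → AM} {w : ℕ → Word}
    (hw : DirectivePrefixes Δ Θ w) (n : ℕ) : w n <+: w (n + 1) :=
  (List.prefix_append _ _).trans (hw.2 n).1

theorem DirectivePrefixes.length_mono {Δ : ℕ → Letter} {Θ : ℕ → AM} {w : ℕ → Word}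
    (hw : DirectivePrefixes Δ Θ w) : Monotone fun n => (w n).length :=
  monotone_nat_of_le_succ fun n => (hw.isPrefix n).length_le

/-- Proposition (one missed prefix, odd case): with a normalized prefix of length
`n`, Assumption A and exactly one missed pseudopalindromic prefix, if
`w n = w_{n-1}·c·ϑ(w_{n-1})` then `w (n+1) = w_n·d·ϑ'(w_n)` for some letter `d`
and some antimorphism `ϑ'`. -/
theorem odd_form_propagates
    (Δ : ℕ → Letter) (Θ : ℕ → AM) (w : ℕ → Word)
    (hw : DirectivePrefixes Δ Θ w) (n : ℕ) (hn : 1 ≤ n)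
    (hnorm : NormalizedUpTo w n)
    (hA : AssumptionA (w n) (w (n + 1)))
    (v : Word) (hv : MissedBetween (w n) (w (n + 1)) v)
    (huniq : ∀ v' : Word, MissedBetween (w n) (w (n + 1)) v' → v' = v)
    (hshape : ∃ (c : Letter) (t : AM),
      w n = w (n - 1) ++ [c] ++ t.apply (w (n - 1))) :
    ∃ (d : Letter) (t' : AM), w (n + 1) = w n ++ [d] ++ t'.apply (w n) := by
  obtain ⟨c, t, hshape⟩ := hshape
  obtain ⟨p, hp0, hpN, hpL, hpN', hlen, ρ, hρ⟩ := hA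
  obtain ⟨m, rfl⟩ : ∃ m, n = m + 1 := ⟨n - 1, by omega⟩
  have hpre := hw.isPrefix (m + 1)
  have hσ := (hw.2 m).2.1
  have hτ := (hw.2 (m + 1)).2.1
  have hle := (hw.2 (m + 1)).length_le
  have hpal : ∀ i j, i + j + 1 = (w (m + 1)).length →
      (w (m + 1)).getD j 0 = (Θ (m + 1)).letter ((w (m + 1)).getD i 0) := fun i j h => by
    rw [← AM.getD_apply _ _ h, hσ]
  set σ := Θ (m + 1)
  set τ := Θ (m + 1 + 1)
  set x := w (m + 1 + 1)
  set L := (w (m + 1)).length with hL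
  set N := x.length with hN
  have htake : w (m + 1) = x.take L := List.prefix_iff_eq_take.mp hpre
  have hLh : L = 2 * (w m).length + 1 := by
    rw [hL, hshape]
    simp [AM.length_apply]
    omega
  rw [List.length_append, ← hL, List.length_singleton] at hle
  have hget : ∀ i < L, (w (m + 1)).getD i 0 = x.getD i 0 := fun i hi => by
    rw [htake]
    simpa using List.getD_take_drop x (p := 0) hi
  have fσ : ∀ i j, i + j + 1 = L → x.getD j 0 = σ.letter (x.getD i 0) := fun i j h => by
    rw [← hget i (by omega), ← hget j (by omega)]
    exact hpal i j h
  have fτ : ∀ i j, i + j + 1 = N → x.getD j 0 = τ.letter (x.getD i 0) := fun i j h => by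
    rw [← AM.getD_apply _ _ h, hτ]
  have focc : ∀ i j, i + j + 1 = L → x.getD (p + j) 0 = ρ.letter (x.getD i 0) := fun i j h => by
    rw [← List.getD_take_drop x (m := L) (by omega), hρ, AM.getD_apply _ _ h, hget i (by omega)]
  clear_value σ τ x
  -- An overlapping image of `w (m + 1)` ends a missed pseudopalindrome.
  have hext : ∀ (q : ℕ) (κ : AM), 0 < q → q < L → q + L < N →
      (∀ i j, i + j + 1 = L → x.getD (q + j) 0 = κ.letter (x.getD i 0)) →
      (∀ i j, i + j + 1 = q + L → x.getD j 0 = κ.letter (x.getD i 0)) ∧ q + L = v.length := by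
    intro q κ hq0 hqL hqN hocc
    have hmir : ∀ i j, i + j + 1 = q + L → x.getD j 0 = κ.letter (x.getD i 0) := by
      intro i j h
      rcases le_or_gt q j with hj | hj
      · obtain ⟨j, rfl⟩ := Nat.exists_eq_add_of_le hj
        exact hocc i j (by omega)
      · obtain ⟨i, rfl⟩ := Nat.exists_eq_add_of_le (show q ≤ i by omega)
        rw [hocc j i (by omega), AM.letter_letter]
    refine ⟨hmir, ?_⟩
    have hl : (x.take (q + L)).length = q + L := by rw [List.length_take]; omega
    rw [← huniq (x.take (q + L)) ⟨List.take_prefix _ _,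
      ⟨κ, κ.apply_take_eq x (by omega) hmir⟩, by omega, by omega⟩, hl]
  obtain ⟨fρ, hpv⟩ := hext p ρ hp0 hpL (by omega) focc
  -- The image mirrored by `τ` overlaps as well, hence starts at the same position.
  have hmirror : ∀ j < L, x.getD (N - L - p + j) 0 = τ.letter (ρ.letter (x.getD j 0)) := by
    intro j hj
    rw [fτ (L + p - 1 - j) (N - L - p + j) (by omega), fρ j (L + p - 1 - j) (by omega)]
  have hsym : N - L - p = p := by
    rcases AM.exists_letter_comp_or ρ τ σ with ⟨κ, hκ⟩ | hfree
    · have := (hext (N - L - p) κ (by omega) (by omega) (by omega) fun i j h => by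
        rw [hmirror j (by omega), fσ i j h, hκ]).2
      omega
    · have hz : ∀ i j, i + j + 1 = L - (N - L - p) →
          x.getD j 0 = ρ.letter (τ.letter (σ.letter (x.getD i 0))) := by
        intro i j h
        rw [← fσ i (N - L - p + j) (by omega), hmirror j (by omega), AM.letter_letter,
          AM.letter_letter]
      refine absurd ?_ (hfree (x.getD 0 0))
      rw [← hz 0 (L - (N - L - p) - 1) (by omega), ← hz (L - (N - L - p) - 1) 0 (by omega)]
  -- The overlap of the two first images is a pseudopalindromic prefix of `w (m + 1)`.
  have hoverlap : L - p ≤ (w m).length := by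
    obtain ⟨κ, hκ⟩ := AM.exists_letter_conj σ ρ
    have hpal' : κ.apply (x.take (L - p)) = x.take (L - p) := by
      refine κ.apply_take_eq x (by omega) fun i j h => ?_
      rw [hκ, ← fσ i (p + j) (by omega), focc (L - 1 - j) j (by omega),
        fσ j (L - 1 - j) (by omega), AM.letter_letter, AM.letter_letter]
    obtain ⟨k, hk, hzk⟩ := hnorm (x.take (L - p))
      (by rw [htake]; exact List.take_prefix_take_left (by omega)) ⟨κ, hpal'⟩
    have hl : (w k).length = L - p := by rw [← hzk, List.length_take]; omega
    have hkm : k ≤ m := by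
      by_contra hlt
      obtain rfl : k = m + 1 := by omega
      omega
    have := hw.length_mono hkm
    simp only at this
    omega
  have hNL : N = 2 * L + 1 := by omega
  refine ⟨x.getD L 0, τ, List.eq_of_getD ?_ fun j hj => ?_⟩
  · simp only [List.length_append, AM.length_apply, List.length_singleton]
    omega
  · rcases lt_trichotomy j L with h | h | h
    · rw [List.append_assoc, List.getD_append _ _ _ _ h, hget j h]
    · subst h
      simp [List.getD_eq_getElem?_getD, hL]
    · have hl : (w (m + 1) ++ [x.getD L 0]).length = L + 1 := by simp [hL]
      rw [List.getD_append_right _ _ _ _ (by omega), hl,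
        AM.getD_apply (i := N - 1 - j) _ _ (by omega), hget _ (by omega)]
      exact fτ _ _ (by omega)
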